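/- Admissibility limit within R₀: let (μⁿ, mⁿ)_{n≥1} ⊆ R₀ be such that mⁿ → m in V for some m ∈ V. Then m_t(Ō×A) ≤ 1 for Lebesgue-a.e. t ∈ [0,T], and for every bounded continuous h : [0,T]×Ō → ℝ the functions t ↦ ∫_{Ō×A} h(t,x) m_tⁿ(dx,da) converge, up to extraction of a subsequence, to t ↦ ∫_{Ō×A} h(t,x) m_t(dx,da) in L¹([0,T]). -/

import Mathlib

open MeasureTheory Filter Set Topology

noncomputable section

/-- Membership in `C_b^{1,2}([0,T] × closure O)`: `u` together with its partial
derivatives `ut = ∂_t u`, `ux = ∂_x u`, `uxx = ∂_xx u`, all continuous and bounded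
on `[0,T] × closure O`. -/
structure IsCb12 (T : ℝ) (O : Set ℝ) (u ut ux uxx : ℝ → ℝ → ℝ) : Prop where
  cont : ContinuousOn (fun p : ℝ × ℝ => u p.1 p.2) (Set.Icc 0 T ×ˢ closure O)
  cont_t : ContinuousOn (fun p : ℝ × ℝ => ut p.1 p.2) (Set.Icc 0 T ×ˢ closure O)
  cont_x : ContinuousOn (fun p : ℝ × ℝ => ux p.1 p.2) (Set.Icc 0 T ×ˢ closure O)
  cont_xx : ContinuousOn (fun p : ℝ × ℝ => uxx p.1 p.2) (Set.Icc 0 T ×ˢ closure O)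
  deriv_t : ∀ t ∈ Set.Icc (0:ℝ) T, ∀ x ∈ closure O,
    HasDerivWithinAt (fun s => u s x) (ut t x) (Set.Icc 0 T) t
  deriv_x : ∀ t ∈ Set.Icc (0:ℝ) T, ∀ x ∈ closure O,
    HasDerivWithinAt (fun y => u t y) (ux t x) (closure O) x
  deriv_xx : ∀ t ∈ Set.Icc (0:ℝ) T, ∀ x ∈ closure O,
    HasDerivWithinAt (fun y => ux t y) (uxx t x) (closure O) x
  bdd : ∃ C : ℝ, ∀ t ∈ Set.Icc (0:ℝ) T, ∀ x ∈ closure O,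
    |u t x| ≤ C ∧ |ut t x| ≤ C ∧ |ux t x| ≤ C ∧ |uxx t x| ≤ C

/-- Membership in `V`: a flow of finite positive Borel measures on
`closure O × A`, measurable in `t`, with integrable total mass on `[0,T]`. -/
def MemV (T : ℝ) (O A : Set ℝ) (m : ℝ → Measure (ℝ × ℝ)) : Prop :=
  (∀ t, m t Set.univ < ⊤) ∧
  (∀ t, m t ((closure O ×ˢ A)ᶜ) = 0) ∧
  (∀ B : Set (ℝ × ℝ), MeasurableSet B → Measurable fun t => m t B) ∧
  IntegrableOn (fun t => (m t Set.univ).toReal) (Set.Icc 0 T)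

/-- Weak convergence of (finite) measures on `[0,T] × closure O` (tested against
bounded continuous functions). -/
def WeakConv (μn : ℕ → Measure (ℝ × ℝ)) (μ : Measure (ℝ × ℝ)) : Prop :=
  ∀ h : ℝ × ℝ → ℝ, Continuous h → (∃ C : ℝ, ∀ p, |h p| ≤ C) →
    Tendsto (fun n => ∫ p, h p ∂(μn n)) atTop (nhds (∫ p, h p ∂μ))

/-- Convergence `mⁿ → m` in `V`: weak convergence of the associated finite
measures `m_tⁿ(dx,da)dt` on `[0,T] × closure O × A`. -/
def ConvV (T : ℝ) (mn : ℕ → ℝ → Measure (ℝ × ℝ)) (m : ℝ → Measure (ℝ × ℝ)) : Prop :=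
  ∀ h : ℝ → ℝ × ℝ → ℝ, Continuous (fun q : ℝ × ℝ × ℝ => h q.1 q.2) →
    (∃ C : ℝ, ∀ t p, |h t p| ≤ C) →
    Tendsto (fun n => ∫ t in Set.Icc 0 T, (∫ p, h t p ∂(mn n t))) atTop
      (nhds (∫ t in Set.Icc 0 T, (∫ p, h t p ∂(m t))))

/-- Mean-field structural assumptions on a coefficient
`c(t,x,m,a) = c̄(t, x, ∫ ĉ(t,y) m(dy,du), a)`: Lipschitz in `x` uniformly in the
other variables; `c̄` bounded, measurable and continuous in the variables other than
`t` for each fixed `t`; `ĉ` continuous and bounded on `[0,T] × closure O`. -/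
def MFCoeff (T : ℝ) (O A : Set ℝ) (d : ℕ)
    (c : ℝ → ℝ → Measure (ℝ × ℝ) → ℝ → ℝ)
    (cbar : ℝ → ℝ → (Fin d → ℝ) → ℝ → ℝ)
    (chat : ℝ → ℝ → Fin d → ℝ) : Prop :=
  (∃ K : ℝ, ∀ t (ν : Measure (ℝ × ℝ)) a x y, |c t x ν a - c t y ν a| ≤ K * |x - y|) ∧
  (∀ t x (ν : Measure (ℝ × ℝ)) a, c t x ν a = cbar t x (fun i => ∫ p, chat t p.1 i ∂ν) a) ∧
  (∃ C : ℝ, ∀ t x z a, |cbar t x z a| ≤ C) ∧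
  Measurable (fun q : ℝ × ℝ × (Fin d → ℝ) × ℝ => cbar q.1 q.2.1 q.2.2.1 q.2.2.2) ∧
  (∀ t, ContinuousOn (fun q : ℝ × (Fin d → ℝ) × ℝ => cbar t q.1 q.2.1 q.2.2)
      (Set.univ ×ˢ Set.univ ×ˢ A)) ∧
  ContinuousOn (fun p : ℝ × ℝ => chat p.1 p.2) (Set.Icc 0 T ×ˢ closure O) ∧
  (∃ C : ℝ, ∀ t x, ‖chat t x‖ ≤ C)

/-- Mean-field structural assumptions on the running reward
`f(t,x,m,a) = f̄(t, x, ∫ f̂(t,y) m(dy,du), a)` with `f̄` bounded, measurable,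
continuous in the variables other than `t` for each fixed `t`, and `f̂` continuous
and bounded. -/
def MFRunning (T : ℝ) (O A : Set ℝ) (d : ℕ)
    (f : ℝ → ℝ → Measure (ℝ × ℝ) → ℝ → ℝ)
    (fbar : ℝ → ℝ → (Fin d → ℝ) → ℝ → ℝ)
    (fhat : ℝ → ℝ → Fin d → ℝ) : Prop :=
  (∀ t x (ν : Measure (ℝ × ℝ)) a, f t x ν a = fbar t x (fun i => ∫ p, fhat t p.1 i ∂ν) a) ∧
  (∃ C : ℝ, ∀ t x z a, |fbar t x z a| ≤ C) ∧
  Measurable (fun q : ℝ × ℝ × (Fin d → ℝ) × ℝ => fbar q.1 q.2.1 q.2.2.1 q.2.2.2) ∧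
  (∀ t, ContinuousOn (fun q : ℝ × (Fin d → ℝ) × ℝ => fbar t q.1 q.2.1 q.2.2)
      (closure O ×ˢ Set.univ ×ˢ A)) ∧
  ContinuousOn (fun p : ℝ × ℝ => fhat p.1 p.2) (Set.Icc 0 T ×ˢ closure O) ∧
  (∃ C : ℝ, ∀ t x, ‖fhat t x‖ ≤ C)

/-- Mean-field structural assumptions on the terminal reward
`g(t,x,μ) = ḡ(t, x, ∫ ĝ(s,y) μ(ds,dy))` with `ḡ` and `ĝ` continuous and bounded. -/
def MFTerminal (T : ℝ) (O : Set ℝ) (d : ℕ)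
    (g : ℝ → ℝ → Measure (ℝ × ℝ) → ℝ)
    (gbar : ℝ → ℝ → (Fin d → ℝ) → ℝ)
    (ghat : ℝ → ℝ → Fin d → ℝ) : Prop :=
  (∀ t x (ν : Measure (ℝ × ℝ)), g t x ν = gbar t x (fun i => ∫ p, ghat p.1 p.2 i ∂ν)) ∧
  ContinuousOn (fun q : ℝ × ℝ × (Fin d → ℝ) => gbar q.1 q.2.1 q.2.2)
    (Set.Icc 0 T ×ˢ closure O ×ˢ Set.univ) ∧
  (∃ C : ℝ, ∀ t x z, |gbar t x z| ≤ C) ∧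
  ContinuousOn (fun p : ℝ × ℝ => ghat p.1 p.2) (Set.Icc 0 T ×ˢ closure O) ∧
  (∃ C : ℝ, ∀ t x, ‖ghat t x‖ ≤ C)

/-- Standing assumption on the initial measure in the mean-field setting: a
probability measure on `O` with `∫ |x|² dm₀* < ∞`. -/
def InitAssumption2 (O : Set ℝ) (m0 : Measure ℝ) : Prop :=
  IsProbabilityMeasure m0 ∧ m0 Oᶜ = 0 ∧ Integrable (fun x => x ^ 2) m0

/-- Membership in `R[m̄]`: the Fokker–Planck constraint with coefficients frozen
along the flow `m̄`. -/
def MemRm (T : ℝ) (O A : Set ℝ)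
    (b σ : ℝ → ℝ → Measure (ℝ × ℝ) → ℝ → ℝ) (m0 : Measure ℝ)
    (mbar : ℝ → Measure (ℝ × ℝ))
    (μ : Measure (ℝ × ℝ)) (m : ℝ → Measure (ℝ × ℝ)) : Prop :=
  IsProbabilityMeasure μ ∧ μ ((Set.Icc 0 T ×ˢ closure O)ᶜ) = 0 ∧ MemV T O A m ∧
  ∀ u ut ux uxx : ℝ → ℝ → ℝ, IsCb12 T O u ut ux uxx →
    ∫ p, u p.1 p.2 ∂μ
      = (∫ x, u 0 x ∂m0)
        + ∫ t in Set.Icc 0 T,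
            (∫ p, (ut t p.1 + (b t p.1 (mbar t) p.2 * ux t p.1
                + σ t p.1 (mbar t) p.2 ^ 2 / 2 * uxx t p.1)) ∂(m t))

/-- Membership in `R₀`: for every test function `u ∈ C_b^{1,2}` and every constant
`C` dominating `|L u|` uniformly over `[0,T] × closure O × M(Ō×A) × A`, the relaxed
Fokker–Planck inequality holds. -/
def MemR0 (T : ℝ) (O A : Set ℝ)
    (b σ : ℝ → ℝ → Measure (ℝ × ℝ) → ℝ → ℝ) (m0 : Measure ℝ)
    (μ : Measure (ℝ × ℝ)) (m : ℝ → Measure (ℝ × ℝ)) : Prop :=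
  IsProbabilityMeasure μ ∧ μ ((Set.Icc 0 T ×ˢ closure O)ᶜ) = 0 ∧ MemV T O A m ∧
  ∀ u ut ux uxx : ℝ → ℝ → ℝ, IsCb12 T O u ut ux uxx →
    ∀ C : ℝ,
      (∀ t ∈ Set.Icc (0:ℝ) T, ∀ x ∈ closure O, ∀ ν : Measure (ℝ × ℝ),
          ν Set.univ < ⊤ → ν ((closure O ×ˢ A)ᶜ) = 0 → ∀ a ∈ A,
          |b t x ν a * ux t x + σ t x ν a ^ 2 / 2 * uxx t x| ≤ C) →
      ∫ p, u p.1 p.2 ∂μ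
        ≤ (∫ x, u 0 x ∂m0)
          + (∫ t in Set.Icc 0 T, (∫ p, ut t p.1 ∂(m t)))
          + C * ∫ t in Set.Icc 0 T, ((m t) Set.univ).toReal

/-- The mean-field reward functional
`Γ[μ̄,m̄](μ,m) = ∫₀^T ∫ f(t,x,m̄_t,a) m_t(dx,da) dt + ∫ g(t,x,μ̄) μ(dt,dx)`. -/
def GammaMF (T : ℝ)
    (f : ℝ → ℝ → Measure (ℝ × ℝ) → ℝ → ℝ) (g : ℝ → ℝ → Measure (ℝ × ℝ) → ℝ)
    (μbar : Measure (ℝ × ℝ)) (mbar : ℝ → Measure (ℝ × ℝ))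
    (μ : Measure (ℝ × ℝ)) (m : ℝ → Measure (ℝ × ℝ)) : ℝ :=
  (∫ t in Set.Icc 0 T, ∫ p, f t p.1 (mbar t) p.2 ∂(m t)) + ∫ p, g p.1 p.2 μbar ∂μ

/-- `(μ⋆, m⋆)` is an LP MFG Nash equilibrium: `(μ⋆, m⋆) ∈ R[m⋆]` and it maximizes
`Γ[μ⋆, m⋆]` over `R[m⋆]`. -/
def IsLPNash (T : ℝ) (O A : Set ℝ)
    (b σ f : ℝ → ℝ → Measure (ℝ × ℝ) → ℝ → ℝ) (g : ℝ → ℝ → Measure (ℝ × ℝ) → ℝ)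
    (m0 : Measure ℝ)
    (μs : Measure (ℝ × ℝ)) (ms : ℝ → Measure (ℝ × ℝ)) : Prop :=
  MemRm T O A b σ m0 ms μs ms ∧
  ∀ (μ : Measure (ℝ × ℝ)) (m : ℝ → Measure (ℝ × ℝ)), MemRm T O A b σ m0 ms μ m →
    GammaMF T f g μs ms μ m ≤ GammaMF T f g μs ms μs ms

/-- The additional assumption (5)(a) or (5)(c): either `b` and `σ` do not depend on
the measure argument, or `O` is an open interval, `σ` does not depend on the control
argument and is uniformly bounded below by a positive constant. -/
def MeasIndepOrInterval (O : Set ℝ)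
    (b σ : ℝ → ℝ → Measure (ℝ × ℝ) → ℝ → ℝ) : Prop :=
  (∀ t x (ν ν' : Measure (ℝ × ℝ)) a, b t x ν a = b t x ν' a ∧ σ t x ν a = σ t x ν' a) ∨
  ((∃ c1 c2 : ℝ, c1 < c2 ∧ O = Set.Ioo c1 c2) ∧
   (∀ t x (ν : Measure (ℝ × ℝ)) a a', σ t x ν a = σ t x ν a') ∧
   (∃ cσ : ℝ, 0 < cσ ∧ ∀ t x (ν : Measure (ℝ × ℝ)) a, cσ ≤ σ t x ν a))


/-- test-function characterisation of `p ≤ 1` a.e. -/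
lemma ae_le_one_of_test (T : ℝ) (p : ℝ → ℝ) (hp : IntegrableOn p (Icc 0 T)) (hpm : Measurable p)
    (H : ∀ η : ℝ → ℝ, Continuous η → (∀ t, 0 ≤ η t) → (∀ t, η t ≤ 1) →
      ∫ t in Icc 0 T, η t * p t ≤ ∫ t in Icc 0 T, η t) :
    ∀ᵐ t ∂(volume.restrict (Icc 0 T)), p t ≤ 1 := by
  by_contra hcon
  have hS : MeasurableSet {t | 1 < p t} := measurableSet_lt measurable_const hpm
  have hpos : 0 < (volume.restrict (Icc 0 T)) {t | 1 < p t} := by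
    rw [pos_iff_ne_zero]
    intro h0
    apply hcon
    rw [ae_iff]
    simpa using h0
  obtain ⟨F, hFS, hFc, hF⟩ := hS.exists_lt_isCompact_of_ne_top (measure_ne_top _ _) hpos
  set ν := volume.restrict (Icc (0:ℝ) T) with hν
  have hδ : ∀ n : ℕ, (0:ℝ) < 1 / ((n:ℝ) + 1) := fun n => by positivity
  let η : ℕ → ℝ → ℝ := fun n t => (thickenedIndicator (hδ n) F t : ℝ)
  have hηc : ∀ n, Continuous (η n) := fun n => by
    exact NNReal.continuous_coe.comp (thickenedIndicator (hδ n) F).continuous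
  have hη0 : ∀ n t, 0 ≤ η n t := fun n t => NNReal.coe_nonneg _
  have hη1 : ∀ n t, η n t ≤ 1 := fun n t => by
    have := thickenedIndicator_le_one (hδ n) F t
    exact NNReal.coe_le_coe.2 this
  have hlim : ∀ t, Tendsto (fun n => η n t) atTop (𝓝 (F.indicator (fun _ => (1:ℝ)) t)) := by
    intro t
    have h1 := thickenedIndicator_tendsto_indicator_closure hδ tendsto_one_div_add_atTop_nhds_zero_nat F
    rw [tendsto_pi_nhds] at h1
    have h2 := (NNReal.continuous_coe.tendsto _).comp (h1 t)
    rw [hFc.isClosed.closure_eq] at h2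
    have e : ((F.indicator (fun _ => (1:NNReal)) t : NNReal) : ℝ) = F.indicator (fun _ => (1:ℝ)) t := by
      by_cases ht : t ∈ F <;> simp [ht]
    rw [← e]
    exact h2
  have hA1 : Tendsto (fun n => ∫ t, η n t * p t ∂ν) atTop
      (𝓝 (∫ t, F.indicator (fun _ => (1:ℝ)) t * p t ∂ν)) := by
    refine tendsto_integral_of_dominated_convergence (fun t => |p t|) ?_ hp.abs ?_ ?_
    · intro n; exact ((hηc n).measurable.mul hpm).aestronglyMeasurable
    · intro n
      filter_upwards with t
      rw [Real.norm_eq_abs, abs_mul, abs_of_nonneg (hη0 n t)]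
      exact mul_le_of_le_one_left (abs_nonneg _) (hη1 n t)
    · filter_upwards with t
      exact (hlim t).mul_const _
  have hA2 : Tendsto (fun n => ∫ t, η n t ∂ν) atTop
      (𝓝 (∫ t, F.indicator (fun _ => (1:ℝ)) t ∂ν)) := by
    refine tendsto_integral_of_dominated_convergence (fun t => (1:ℝ)) ?_ (integrable_const _) ?_ ?_
    · intro n; exact ((hηc n).measurable).aestronglyMeasurable
    · intro n
      filter_upwards with t
      rw [Real.norm_eq_abs, abs_of_nonneg (hη0 n t)]
      exact hη1 n t
    · filter_upwards with t
      exact hlim t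
  have hle := le_of_tendsto_of_tendsto' hA1 hA2 (fun n => H (η n) (hηc n) (hη0 n) (hη1 n))
  have e1 : ∀ t, F.indicator (fun _ => (1:ℝ)) t * p t = F.indicator p t := by
    intro t; by_cases ht : t ∈ F <;> simp [ht]
  simp_rw [e1] at hle
  rw [integral_indicator hFc.measurableSet, integral_indicator hFc.measurableSet] at hle
  have hpF : IntegrableOn p F ν := Integrable.integrableOn hp
  have h1F : IntegrableOn (fun _ => (1:ℝ)) F ν := (integrable_const _).integrableOn
  have hsub : 0 < ∫ t in F, (p t - 1) ∂ν := by
    rw [setIntegral_pos_iff_support_of_nonneg_ae]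
    · refine lt_of_lt_of_le hF (measure_mono ?_)
      intro t ht
      refine ⟨?_, ht⟩
      have := hFS ht
      simp only [mem_ofPred_eq] at this
      simp only [Function.mem_support]
      linarith
    · filter_upwards [ae_restrict_mem hFc.measurableSet] with t ht
      have := hFS ht
      simp only [mem_ofPred_eq] at this
      simp only [Pi.zero_apply]
      linarith
    · exact hpF.sub h1F
  rw [integral_sub hpF h1F] at hsub
  linarith

lemma integrable_of_bdd_meas (T : ℝ) {g : ℝ → ℝ} (hg : Measurable g) {M : ℝ} (hM : ∀ t, |g t| ≤ M) :
    Integrable g (volume.restrict (Icc 0 T)) :=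
  Integrable.of_bound hg.aestronglyMeasurable M (ae_of_all _ hM)

/-- weak convergence against continuous functions upgrades to `L¹` test functions. -/
lemma weak_L1_test (T : ℝ) (gn : ℕ → ℝ → ℝ) (g : ℝ → ℝ) (M : ℝ)
    (hgn : ∀ n, Measurable (gn n)) (hg : Measurable g)
    (hMn : ∀ n t, |gn n t| ≤ M) (hM : ∀ t, |g t| ≤ M)
    (hw : ∀ η : ℝ → ℝ, Continuous η → (∃ C, ∀ t, |η t| ≤ C) →
      Tendsto (fun n => ∫ t in Icc 0 T, η t * gn n t) atTop (𝓝 (∫ t in Icc 0 T, η t * g t)))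
    (f : ℝ → ℝ) (hf : Integrable f (volume.restrict (Icc 0 T))) :
    Tendsto (fun n => ∫ t in Icc 0 T, f t * gn n t) atTop (𝓝 (∫ t in Icc 0 T, f t * g t)) := by
  have hM0 : 0 ≤ M := (abs_nonneg _).trans (hM 0)
  rw [Metric.tendsto_atTop]
  intro ε hε
  obtain ⟨ρ, hρs, hρ, hρc, hρi⟩ := hf.exists_hasCompactSupport_integral_sub_le
    (ε := ε / (4 * (M + 1))) (by positivity)
  obtain ⟨C, hC⟩ := hρs.exists_bound_of_continuous hρc
  obtain ⟨N, hN⟩ := (Metric.tendsto_atTop.1 (hw ρ hρc ⟨C, hC⟩)) (ε / 2) (by positivity)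
  refine ⟨N, fun n hn => ?_⟩
  have hN' := hN n hn
  rw [Real.dist_eq] at hN' ⊢
  have key : ∀ k : ℝ → ℝ, Measurable k → (∀ t, |k t| ≤ M) →
      |(∫ t in Icc 0 T, f t * k t) - ∫ t in Icc 0 T, ρ t * k t| ≤ ε / 4 := by
    intro k hk hkM
    have i1 : Integrable (fun t => f t * k t) (volume.restrict (Icc 0 T)) :=
      hf.mul_bdd hk.aestronglyMeasurable (ae_of_all _ hkM)
    have i2 : Integrable (fun t => ρ t * k t) (volume.restrict (Icc 0 T)) :=
      hρi.mul_bdd hk.aestronglyMeasurable (ae_of_all _ hkM)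
    rw [← integral_sub i1 i2]
    calc |∫ t in Icc 0 T, (f t * k t - ρ t * k t)| 
        ≤ ∫ t in Icc 0 T, |f t * k t - ρ t * k t| := abs_integral_le_integral_abs
      _ ≤ ∫ t in Icc 0 T, ‖f t - ρ t‖ * M := by
          refine integral_mono (i1.sub i2).abs ((hf.sub hρi).norm.mul_const M) ?_
          intro t
          simp only
          rw [← sub_mul, abs_mul]
          exact mul_le_mul_of_nonneg_left (hkM t) (abs_nonneg _)
      _ = (∫ t in Icc 0 T, ‖f t - ρ t‖) * M := integral_mul_const _ _
      _ ≤ ε / (4 * (M + 1)) * M := mul_le_mul_of_nonneg_right hρ hM0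
      _ ≤ ε / (4 * (M + 1)) * (M + 1) := by
          apply mul_le_mul_of_nonneg_left _ (by positivity); linarith
      _ = ε / 4 := by field_simp
  have k1 := abs_le.1 (key (gn n) (hgn n) (hMn n))
  have k2 := abs_le.1 (key g hg hM)
  have k3 := abs_lt.1 hN'
  rw [abs_lt]
  constructor <;> linarith

/-- Uniform convergence of primitives. -/
lemma unif_primitive (T : ℝ) (hT : 0 < T) (gn : ℕ → ℝ → ℝ) (g : ℝ → ℝ) (M : ℝ)
    (hgn : ∀ n, Measurable (gn n)) (hg : Measurable g)
    (hMn : ∀ n t, |gn n t| ≤ M) (hM : ∀ t, |g t| ≤ M)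
    (hw : ∀ η : ℝ → ℝ, Continuous η → (∃ C, ∀ t, |η t| ≤ C) →
      Tendsto (fun n => ∫ t in Icc 0 T, η t * gn n t) atTop (𝓝 (∫ t in Icc 0 T, η t * g t)))
    (ε : ℝ) (hε : 0 < ε) :
    ∀ᶠ n in atTop, ∀ t ∈ Icc 0 T, |∫ s in (0:ℝ)..t, (gn n s - g s)| ≤ ε := by
  have hM0 : 0 ≤ M := (abs_nonneg _).trans (hM 0)
  have hii : ∀ n a b, IntervalIntegrable (fun s => gn n s - g s) volume a b := by
    intro n a b
    rw [intervalIntegrable_iff]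
    refine IntegrableOn.of_bound (C := 2 * M) (by simp) ((hgn n).sub hg).aestronglyMeasurable ?_
    filter_upwards with t
    have := abs_sub (gn n t) (g t)
    rw [Real.norm_eq_abs]
    linarith [hMn n t, hM t]
  have hpt : ∀ t ∈ Icc 0 T, Tendsto (fun n => ∫ s in (0:ℝ)..t, (gn n s - g s)) atTop (𝓝 0) := by
    intro t ht
    have hi : Integrable ((Ioc 0 t).indicator (fun _ => (1:ℝ))) (volume.restrict (Icc 0 T)) :=
      (integrable_const _).indicator measurableSet_Ioc
    have h := weak_L1_test T gn g M hgn hg hMn hM hw _ hi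
    have e : ∀ k : ℝ → ℝ, ∫ s in Icc 0 T, (Ioc 0 t).indicator (fun _ => (1:ℝ)) s * k s
        = ∫ s in (0:ℝ)..t, k s := by
      intro k
      rw [intervalIntegral.integral_of_le ht.1]
      have : ∀ s, (Ioc 0 t).indicator (fun _ => (1:ℝ)) s * k s = (Ioc 0 t).indicator k s := by
        intro s; by_cases hs : s ∈ Ioc 0 t <;> simp [hs]
      simp_rw [this]
      rw [setIntegral_indicator measurableSet_Ioc]
      congr 2
      apply inter_eq_self_of_subset_right
      exact fun s hs => ⟨hs.1.le, hs.2.trans ht.2⟩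
    simp_rw [e] at h
    have h' := h.sub_const (∫ s in (0:ℝ)..t, g s)
    rw [sub_self] at h'
    refine h'.congr fun n => ?_
    rw [intervalIntegral.integral_sub]
    · rw [intervalIntegrable_iff]
      exact IntegrableOn.of_bound (C := M) (by simp) (hgn n).aestronglyMeasurable (ae_of_all _ (hMn n))
    · rw [intervalIntegrable_iff]
      exact IntegrableOn.of_bound (C := M) (by simp) hg.aestronglyMeasurable (ae_of_all _ hM)
  -- finite net
  obtain ⟨N, hN⟩ := exists_nat_gt (T * (4 * (M + 1)) / ε)
  have hNpos : (0:ℝ) < N := lt_of_le_of_lt (by positivity) hN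
  have hev : ∀ᶠ n in atTop, ∀ j ∈ Finset.range (N + 1),
      |∫ s in (0:ℝ)..(j * T / N), (gn n s - g s)| < ε / 2 := by
    rw [Filter.eventually_all_finset]
    intro j hj
    have hjN : (j:ℝ) ≤ N := by
      have := Finset.mem_range.1 hj
      exact_mod_cast Nat.lt_succ_iff.1 this
    have h := hpt (j * T / N) ⟨by positivity, by
      rw [div_le_iff₀ hNpos, mul_comm]; exact mul_le_mul_of_nonneg_left hjN hT.le⟩
    have h2 := h.abs
    rw [abs_zero] at h2
    exact h2.eventually_lt_const (by positivity)
  filter_upwards [hev] with n hn t ht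
  set j := ⌊t * N / T⌋₊ with hj
  have hj1 : (j:ℝ) ≤ t * N / T := Nat.floor_le (by have := ht.1; positivity)
  have hj2 : t * N / T < j + 1 := Nat.lt_floor_add_one _
  have hjN : j ≤ N := by
    have : (j:ℝ) ≤ N := hj1.trans (by
      rw [div_le_iff₀ hT, mul_comm]; exact mul_le_mul_of_nonneg_left ht.2 hNpos.le)
    exact_mod_cast this
  have h1 := hn j (Finset.mem_range.2 (Nat.lt_succ_of_le hjN))
  have h2 : (∫ s in (0:ℝ)..t, (gn n s - g s)) = (∫ s in (0:ℝ)..(j * T / N), (gn n s - g s))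
      + ∫ s in (j * T / N)..t, (gn n s - g s) :=
    (intervalIntegral.integral_add_adjacent_intervals (hii _ _ _) (hii _ _ _)).symm
  have h3 : |∫ s in (j * T / N)..t, (gn n s - g s)| ≤ 2 * M * |t - j * T / N| := by
    rw [← Real.norm_eq_abs]
    refine intervalIntegral.norm_integral_le_of_norm_le_const ?_
    intro s _
    have := abs_sub (gn n s) (g s)
    rw [Real.norm_eq_abs]
    linarith [hMn n s, hM s]
  have h4 : |t - j * T / N| ≤ T / N := by
    have a1 : j * T / N ≤ t := by
      rw [div_le_iff₀ hNpos]; rwa [le_div_iff₀ hT] at hj1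
    have a2 : t ≤ (j + 1) * T / N := by
      rw [le_div_iff₀ hNpos]; rw [div_lt_iff₀ hT] at hj2; exact hj2.le
    have a3 : (j + 1) * T / N = j * T / N + T / N := by ring
    rw [abs_of_nonneg (by linarith)]; linarith
  have h5 : 2 * M * (T / N) ≤ ε / 2 := by
    rw [div_lt_iff₀ hε] at hN
    have : 2 * M * (T / N) = 2 * M * T / N := by ring
    rw [this, div_le_iff₀ hNpos]
    nlinarith
  rw [h2]
  calc _ ≤ _ := abs_add_le _ _
    _ ≤ ε / 2 + 2 * M * |t - j * T / N| := add_le_add h1.le h3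
    _ ≤ ε / 2 + 2 * M * (T / N) := by gcongr
    _ ≤ ε := by linarith

/-- Compensated compactness in one dimension. -/
lemma L1_conv_of_BV (T : ℝ) (hT : 0 < T) (gn : ℕ → ℝ → ℝ) (g : ℝ → ℝ) (M K : ℝ)
    (hgn : ∀ n, Measurable (gn n)) (hg : Measurable g)
    (hMn : ∀ n t, |gn n t| ≤ M) (hM : ∀ t, |g t| ≤ M)
    (hw : ∀ η : ℝ → ℝ, Continuous η → (∃ C, ∀ t, |η t| ≤ C) →
      Tendsto (fun n => ∫ t in Icc 0 T, η t * gn n t) atTop (𝓝 (∫ t in Icc 0 T, η t * g t)))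
    (hBV : ∀ n (ρ : ℝ → ℝ) (B : ℝ), Continuous ρ → (∀ t ∈ Icc 0 T, |∫ s in (0:ℝ)..t, ρ s| ≤ B) →
      |∫ t in Icc 0 T, ρ t * gn n t| ≤ K * B) :
    Tendsto (fun n => ∫ t in Icc 0 T, |gn n t - g t|) atTop (𝓝 0) := by
  have hM0 : 0 ≤ M := (abs_nonneg _).trans (hM 0)
  have hK0 : 0 ≤ K := by
    have := hBV 0 (fun _ => 0) 1 continuous_const (by intro t _; simp)
    simpa using this
  have hdM : ∀ n t, |gn n t - g t| ≤ 2 * M := fun n t => by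
    have := abs_sub (gn n t) (g t)
    linarith [hMn n t, hM t]
  have hdi : ∀ n, Integrable (fun t => gn n t - g t) (volume.restrict (Icc 0 T)) := fun n =>
    integrable_of_bdd_meas T ((hgn n).sub hg) (hdM n)
  have hsqi : ∀ n, Integrable (fun t => (gn n t - g t) ^ 2) (volume.restrict (Icc 0 T)) := fun n => by
    have : Integrable (fun t => (gn n t - g t) * (gn n t - g t)) (volume.restrict (Icc 0 T)) :=
      (hdi n).mul_bdd ((hgn n).sub hg).aestronglyMeasurable (ae_of_all _ (hdM n))
    simpa [sq] using this
  have hsq : ∀ ε > 0, ∀ᶠ n in atTop, ∫ t in Icc 0 T, (gn n t - g t) ^ 2 ≤ (2 * M + 4 * K) * ε := by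
    intro ε hε
    filter_upwards [unif_primitive T hT gn g M hgn hg hMn hM hw ε hε] with n hn
    obtain ⟨ρ, hρs, hρ, hρc, hρi⟩ := (hdi n).exists_hasCompactSupport_integral_sub_le hε
    obtain ⟨C, hC⟩ := hρs.exists_bound_of_continuous hρc
    have hB : ∀ t ∈ Icc 0 T, |∫ s in (0:ℝ)..t, ρ s| ≤ 2 * ε := by
      intro t ht
      have hsub : Ioc 0 t ⊆ Icc 0 T := fun s hs => ⟨hs.1.le, hs.2.trans ht.2⟩
      have i1 : IntegrableOn (fun t => gn n t - g t) (Ioc 0 t) :=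
        IntegrableOn.mono_set (hdi n) hsub
      have i2 : IntegrableOn ρ (Ioc 0 t) := IntegrableOn.mono_set hρi hsub
      have hnt := hn t ht
      rw [intervalIntegral.integral_of_le ht.1] at hnt ⊢
      have e : ∫ s in Ioc 0 t, ρ s = (∫ s in Ioc 0 t, (gn n s - g s)) -
          ∫ s in Ioc 0 t, (gn n s - g s - ρ s) := by
        have i3 : IntegrableOn (fun s => gn n s - g s - ρ s) (Ioc 0 t) := i1.sub i2
        rw [← integral_sub i1 i3]
        congr 1; ext s; ring
      have b : |∫ s in Ioc 0 t, (gn n s - g s - ρ s)| ≤ ε := by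
        calc _ ≤ ∫ s in Ioc 0 t, |gn n s - g s - ρ s| := abs_integral_le_integral_abs
          _ ≤ ∫ s in Icc 0 T, |gn n s - g s - ρ s| := by
              refine setIntegral_mono_set ((hdi n).sub hρi).abs ?_ ?_
              · exact ae_of_all _ fun s => abs_nonneg _
              · exact hsub.eventuallyLE
          _ ≤ ε := hρ
      rw [e]
      have := abs_sub (∫ s in Ioc 0 t, (gn n s - g s)) (∫ s in Ioc 0 t, (gn n s - g s - ρ s))
      linarith
    have c1 := hBV n ρ _ hρc hB
    have c2 : |∫ t in Icc 0 T, ρ t * g t| ≤ K * (2 * ε) :=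
      le_of_tendsto' ((hw ρ hρc ⟨C, hC⟩).abs) (fun k => hBV k ρ _ hρc hB)
    have j1 : Integrable (fun t => ρ t * gn n t) (volume.restrict (Icc 0 T)) :=
      hρi.mul_bdd (hgn n).aestronglyMeasurable (ae_of_all _ (hMn n))
    have j2 : Integrable (fun t => ρ t * g t) (volume.restrict (Icc 0 T)) :=
      hρi.mul_bdd hg.aestronglyMeasurable (ae_of_all _ hM)
    have j3 : Integrable (fun t => (gn n t - g t - ρ t) * (gn n t - g t))
        (volume.restrict (Icc 0 T)) :=
      ((hdi n).sub hρi).mul_bdd ((hgn n).sub hg).aestronglyMeasurable (ae_of_all _ (hdM n))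
    have e : ∫ t in Icc 0 T, (gn n t - g t) ^ 2 =
        (∫ t in Icc 0 T, (gn n t - g t - ρ t) * (gn n t - g t)) +
        ((∫ t in Icc 0 T, ρ t * gn n t) - ∫ t in Icc 0 T, ρ t * g t) := by
      have j4 : Integrable (fun t => ρ t * gn n t - ρ t * g t) (volume.restrict (Icc 0 T)) := j1.sub j2
      rw [← integral_sub j1 j2, ← integral_add j3 j4]
      congr 1; ext s; ring
    have b : ∫ t in Icc 0 T, (gn n t - g t - ρ t) * (gn n t - g t) ≤ ε * (2 * M) := by
      calc _ ≤ ∫ t in Icc 0 T, ‖gn n t - g t - ρ t‖ * (2 * M) := by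
            refine integral_mono j3 (((hdi n).sub hρi).norm.mul_const _) ?_
            intro t
            calc (gn n t - g t - ρ t) * (gn n t - g t)
                ≤ |(gn n t - g t - ρ t) * (gn n t - g t)| := le_abs_self _
              _ = |gn n t - g t - ρ t| * |gn n t - g t| := abs_mul _ _
              _ ≤ _ := mul_le_mul_of_nonneg_left (hdM n t) (abs_nonneg _)
        _ = (∫ t in Icc 0 T, ‖gn n t - g t - ρ t‖) * (2 * M) := integral_mul_const _ _
        _ ≤ _ := mul_le_mul_of_nonneg_right hρ (by positivity)
    rw [e]
    have := abs_le.1 c1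
    have := abs_le.1 c2
    linarith
  rw [Metric.tendsto_nhds]
  intro ε hε
  obtain ⟨δ, hδ⟩ : ∃ δ, δ = ε / (4 * T) := ⟨_, rfl⟩
  have hδ0 : 0 < δ := by rw [hδ]; positivity
  have hD : 0 < 2 * M + 4 * K + 1 := by positivity
  filter_upwards [hsq (ε * (4 * δ) / (4 * (2 * M + 4 * K + 1))) (by positivity)] with n hn
  have h0 : 0 ≤ ∫ t in Icc 0 T, |gn n t - g t| := integral_nonneg fun t => abs_nonneg _
  rw [Real.dist_eq, sub_zero, abs_of_nonneg h0]
  have h1 : ∫ t in Icc 0 T, |gn n t - g t| ≤ ∫ t in Icc 0 T, (δ + (gn n t - g t) ^ 2 / (4 * δ)) := by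
    refine integral_mono (hdi n).abs ((integrable_const _).add ((hsqi n).div_const _)) ?_
    intro t
    simp only
    have e : δ + (gn n t - g t) ^ 2 / (4 * δ) - |gn n t - g t|
        = (2 * δ - |gn n t - g t|) ^ 2 / (4 * δ) := by
      rw [← sq_abs (gn n t - g t)]; field_simp; ring
    have : 0 ≤ (2 * δ - |gn n t - g t|) ^ 2 / (4 * δ) := by positivity
    linarith
  rw [integral_add (integrable_const _) ((hsqi n).div_const _), integral_div] at h1
  have h2 : ∫ t in Icc 0 T, δ = T * δ := by
    simp [hT.le]
  have h3 : (∫ t in Icc 0 T, (gn n t - g t) ^ 2) / (4 * δ) ≤ ε / 4 := by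
    rw [div_le_iff₀ (by positivity)]
    refine hn.trans ?_
    rw [← mul_div_assoc, div_le_iff₀ (by positivity)]
    have : 0 < ε * δ := by positivity
    nlinarith
  have h4 : T * δ = ε / 4 := by rw [hδ]; field_simp
  linarith

lemma isCb12_prod (T : ℝ) (O : Set ℝ) (ρ ψ ψ1 ψ2 : ℝ → ℝ) (D : ℝ) (hρ : Continuous ρ)
    (h0 : Continuous ψ) (h1 : Continuous ψ1) (h2 : Continuous ψ2)
    (hd1 : ∀ x, HasDerivAt ψ (ψ1 x) x) (hd2 : ∀ x, HasDerivAt ψ1 (ψ2 x) x)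
    (hD : ∀ x, |ψ x| ≤ D ∧ |ψ1 x| ≤ D ∧ |ψ2 x| ≤ D) :
    IsCb12 T O (fun t x => (∫ s in (0:ℝ)..t, ρ s) * ψ x) (fun t x => ρ t * ψ x)
      (fun t x => (∫ s in (0:ℝ)..t, ρ s) * ψ1 x) (fun t x => (∫ s in (0:ℝ)..t, ρ s) * ψ2 x) := by
  have hφd : ∀ t, HasDerivAt (fun t => ∫ s in (0:ℝ)..t, ρ s) (ρ t) t := fun t =>
    intervalIntegral.integral_hasDerivAt_right (hρ.intervalIntegrable _ _)
      (hρ.stronglyMeasurableAtFilter _ _) hρ.continuousAt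
  have hφc : Continuous (fun t => ∫ s in (0:ℝ)..t, ρ s) :=
    continuous_iff_continuousAt.2 fun t => (hφd t).continuousAt
  obtain ⟨B1, hB1⟩ := (isCompact_Icc (a := (0:ℝ)) (b := T)).exists_bound_of_continuousOn hφc.continuousOn
  obtain ⟨B2, hB2⟩ := (isCompact_Icc (a := (0:ℝ)) (b := T)).exists_bound_of_continuousOn hρ.continuousOn
  have hD0 : 0 ≤ D := (abs_nonneg _).trans (hD 0).1
  refine ⟨?_, ?_, ?_, ?_, ?_, ?_, ?_, ?_⟩
  · exact ((hφc.comp continuous_fst).mul (h0.comp continuous_snd)).continuousOn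
  · exact ((hρ.comp continuous_fst).mul (h0.comp continuous_snd)).continuousOn
  · exact ((hφc.comp continuous_fst).mul (h1.comp continuous_snd)).continuousOn
  · exact ((hφc.comp continuous_fst).mul (h2.comp continuous_snd)).continuousOn
  · intro t _ x _
    exact ((hφd t).mul_const _).hasDerivWithinAt
  · intro t _ x _
    exact ((hd1 x).const_mul _).hasDerivWithinAt
  · intro t _ x _
    exact ((hd2 x).const_mul _).hasDerivWithinAt
  · refine ⟨max B1 B2 * D, fun t ht x _ => ?_⟩
    have b1 : |∫ s in (0:ℝ)..t, ρ s| ≤ max B1 B2 := (hB1 t ht).trans (le_max_left _ _)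
    have b2 : |ρ t| ≤ max B1 B2 := (hB2 t ht).trans (le_max_right _ _)
    have hB : 0 ≤ max B1 B2 := (abs_nonneg _).trans b1
    obtain ⟨d0, d1, d2⟩ := hD x
    simp only [abs_mul]
    exact ⟨mul_le_mul b1 d0 (abs_nonneg _) hB, mul_le_mul b2 d0 (abs_nonneg _) hB,
      mul_le_mul b1 d1 (abs_nonneg _) hB, mul_le_mul b1 d2 (abs_nonneg _) hB⟩

lemma R0_test {T : ℝ} {O A : Set ℝ} {b σ : ℝ → ℝ → Measure (ℝ × ℝ) → ℝ → ℝ} {m0 : Measure ℝ}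
    {μ : Measure (ℝ × ℝ)} {m : ℝ → Measure (ℝ × ℝ)} (hR : MemR0 T O A b σ m0 μ m)
    (ρ ψ ψ1 ψ2 : ℝ → ℝ) (D : ℝ) (hρ : Continuous ρ)
    (h0 : Continuous ψ) (h1 : Continuous ψ1) (h2 : Continuous ψ2)
    (hd1 : ∀ x, HasDerivAt ψ (ψ1 x) x) (hd2 : ∀ x, HasDerivAt ψ1 (ψ2 x) x)
    (hD : ∀ x, |ψ x| ≤ D ∧ |ψ1 x| ≤ D ∧ |ψ2 x| ≤ D) (C : ℝ)
    (hC : ∀ t ∈ Icc 0 T, ∀ x ν a, |b t x ν a * ((∫ s in (0:ℝ)..t, ρ s) * ψ1 x)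
      + σ t x ν a ^ 2 / 2 * ((∫ s in (0:ℝ)..t, ρ s) * ψ2 x)| ≤ C) :
    ∫ p, (∫ s in (0:ℝ)..p.1, ρ s) * ψ p.2 ∂μ
        ≤ (∫ t in Icc 0 T, ρ t * (∫ p, ψ p.1 ∂(m t)))
          + C * ∫ t in Icc 0 T, ((m t) univ).toReal := by
  have h := hR.2.2.2 _ _ _ _ (isCb12_prod T O ρ ψ ψ1 ψ2 D hρ h0 h1 h2 hd1 hd2 hD) C
    (fun t ht x _ ν _ _ a _ => hC t ht x ν a)
  simpa [integral_const_mul] using h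

lemma R0_mass_le_one {T : ℝ} {O A : Set ℝ} {b σ : ℝ → ℝ → Measure (ℝ × ℝ) → ℝ → ℝ} {m0 : Measure ℝ}
    {μ : Measure (ℝ × ℝ)} {m : ℝ → Measure (ℝ × ℝ)} (hR : MemR0 T O A b σ m0 μ m)
    (η : ℝ → ℝ) (hη : Continuous η) (hη0 : ∀ t, 0 ≤ η t) :
    ∫ t in Icc 0 T, η t * ((m t) univ).toReal ≤ ∫ t in Icc 0 T, η t := by
  have h := R0_test hR η (fun _ => -1) (fun _ => 0) (fun _ => 0) 1 hη continuous_const continuous_const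
    continuous_const (fun x => hasDerivAt_const _ _) (fun x => hasDerivAt_const _ _)
    (fun x => by simp) 0 (fun t _ x ν a => by simp)
  have hprob := hR.1
  simp only [mul_neg, mul_one, integral_neg, integral_const, smul_eq_mul, zero_mul, add_zero,
    neg_le_neg_iff, Measure.real] at h
  refine h.trans ?_
  have hae : ∀ᵐ p ∂μ, p ∈ Icc 0 T ×ˢ closure O := by
    rw [ae_iff]; exact hR.2.1
  have : ∫ p, (∫ s in (0:ℝ)..p.1, η s) ∂μ ≤ ∫ p, (∫ t in Icc 0 T, η t) ∂μ := by
    refine integral_mono_of_nonneg ?_ (integrable_const _) ?_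
    · filter_upwards [hae] with p hp
      exact intervalIntegral.integral_nonneg hp.1.1 fun s _ => hη0 s
    · filter_upwards [hae] with p hp
      rw [intervalIntegral.integral_of_le hp.1.1]
      refine setIntegral_mono_set hη.continuousOn.integrableOn_Icc (ae_of_all _ hη0) ?_
      exact HasSubset.Subset.eventuallyLE fun s hs => ⟨hs.1.le, hs.2.trans hp.1.2⟩
  simpa using this

lemma R0_BV {T : ℝ} {O A : Set ℝ} {b σ : ℝ → ℝ → Measure (ℝ × ℝ) → ℝ → ℝ} {m0 : Measure ℝ}
    (hT : 0 < T)
    (Cb Cs : ℝ) (hb : ∀ t x ν a, |b t x ν a| ≤ Cb) (hs : ∀ t x ν a, |σ t x ν a| ≤ Cs)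
    (ψ ψ1 ψ2 : ℝ → ℝ) (D : ℝ)
    (h0 : Continuous ψ) (h1 : Continuous ψ1) (h2 : Continuous ψ2)
    (hd1 : ∀ x, HasDerivAt ψ (ψ1 x) x) (hd2 : ∀ x, HasDerivAt ψ1 (ψ2 x) x)
    (hD : ∀ x, |ψ x| ≤ D ∧ |ψ1 x| ≤ D ∧ |ψ2 x| ≤ D)
    {μ : Measure (ℝ × ℝ)} {m : ℝ → Measure (ℝ × ℝ)} (hR : MemR0 T O A b σ m0 μ m)
    (ρ : ℝ → ℝ) (B : ℝ) (hρ : Continuous ρ) (hB : ∀ t ∈ Icc 0 T, |∫ s in (0:ℝ)..t, ρ s| ≤ B) :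
    |∫ t in Icc 0 T, ρ t * (∫ p, ψ p.1 ∂(m t))| ≤ (D + (Cb * D + Cs ^ 2 / 2 * D) * T) * B := by
  have hD0 : 0 ≤ D := (abs_nonneg _).trans (hD 0).1
  have hB0 : 0 ≤ B := (abs_nonneg _).trans (hB 0 ⟨le_rfl, hT.le⟩)
  have hCb0 : 0 ≤ Cb := (abs_nonneg _).trans (hb 0 0 0 0)
  have hprob := hR.1
  have hae : ∀ᵐ p ∂μ, p ∈ Icc 0 T ×ˢ closure O := by
    rw [ae_iff]; exact hR.2.1
  have hmass : ∫ t in Icc 0 T, ((m t) univ).toReal ≤ T := by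
    have := R0_mass_le_one hR (fun _ => 1) continuous_const (fun _ => zero_le_one)
    simpa [hT.le] using this
  have hbase : ∀ t ∈ Icc 0 T, ∀ x ν a (y1 y2 : ℝ), |y1| ≤ D → |y2| ≤ D →
      |b t x ν a * ((∫ s in (0:ℝ)..t, ρ s) * y1)
      + σ t x ν a ^ 2 / 2 * ((∫ s in (0:ℝ)..t, ρ s) * y2)| ≤ (Cb * D + Cs ^ 2 / 2 * D) * B := by
    intro t ht x ν a y1 y2 hy1 hy2
    have hs2 : σ t x ν a ^ 2 ≤ Cs ^ 2 := by
      rw [← sq_abs]; exact pow_le_pow_left₀ (abs_nonneg _) (hs t x ν a) 2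
    calc _ ≤ _ := abs_add_le _ _
      _ = |b t x ν a| * (|∫ s in (0:ℝ)..t, ρ s| * |y1|)
          + σ t x ν a ^ 2 / 2 * (|∫ s in (0:ℝ)..t, ρ s| * |y2|) := by
          rw [abs_mul, abs_mul, abs_mul, abs_mul, abs_of_nonneg (a := σ t x ν a ^ 2 / 2) (by positivity)]
      _ ≤ Cb * (B * D) + Cs ^ 2 / 2 * (B * D) := by
          have := hb t x ν a
          have := hB t ht
          gcongr
      _ = _ := by ring
  have hint : ∀ f : ℝ → ℝ, (∀ x, |f x| ≤ D) →
      |∫ p, (∫ s in (0:ℝ)..p.1, ρ s) * f p.2 ∂μ| ≤ B * D := by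
    intro f hf
    have := norm_integral_le_of_norm_le_const (μ := μ)
      (f := fun p : ℝ × ℝ => (∫ s in (0:ℝ)..p.1, ρ s) * f p.2) (C := B * D) (by
        filter_upwards [hae] with p hp
        rw [Real.norm_eq_abs, abs_mul]
        exact mul_le_mul (hB _ hp.1) (hf _) (abs_nonneg _) hB0)
    simpa using this
  have hCT : (Cb * D + Cs ^ 2 / 2 * D) * B * ∫ t in Icc 0 T, ((m t) univ).toReal
      ≤ (Cb * D + Cs ^ 2 / 2 * D) * B * T := mul_le_mul_of_nonneg_left hmass (by positivity)
  have r1 := R0_test hR ρ ψ ψ1 ψ2 D hρ h0 h1 h2 hd1 hd2 hD _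
    (fun t ht x ν a => hbase t ht x ν a (ψ1 x) (ψ2 x) (hD x).2.1 (hD x).2.2)
  have r2 := R0_test hR ρ (fun x => -ψ x) (fun x => -ψ1 x) (fun x => -ψ2 x) D hρ h0.neg h1.neg h2.neg
    (fun x => (hd1 x).neg) (fun x => (hd2 x).neg) (by simpa using hD) _
    (fun t ht x ν a => hbase t ht x ν a (-ψ1 x) (-ψ2 x) (by simpa using (hD x).2.1)
      (by simpa using (hD x).2.2))
  simp only [integral_neg, mul_neg] at r2
  have i1 := abs_le.1 (hint ψ fun x => (hD x).1)
  rw [abs_le]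
  constructor <;> nlinarith

/-- sub-probability kernel version of a flow -/
lemma exists_kernel {T : ℝ} {O A : Set ℝ} {m : ℝ → Measure (ℝ × ℝ)} (hm : MemV T O A m)
    (hle : ∀ᵐ t ∂(volume.restrict (Icc 0 T)), ((m t) univ).toReal ≤ 1) :
    ∃ κ : ProbabilityTheory.Kernel ℝ (ℝ × ℝ), (∀ t, κ t univ ≤ 1) ∧
      (∀ t, κ t ((closure O ×ˢ A)ᶜ) = 0) ∧ (∀ᵐ t ∂(volume.restrict (Icc 0 T)), m t = κ t) := by
  classical
  have hmeas : Measurable m := Measure.measurable_of_measurable_coe _ hm.2.2.1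
  have hS : MeasurableSet {t | m t univ ≤ 1} :=
    measurableSet_le (hm.2.2.1 _ MeasurableSet.univ) measurable_const
  refine ⟨⟨fun t => if m t univ ≤ 1 then m t else 0, Measurable.ite hS hmeas measurable_const⟩,
    ?_, ?_, ?_⟩
  · intro t
    change (if m t univ ≤ 1 then m t else 0) univ ≤ 1
    split_ifs with h
    · exact h
    · simp
  · intro t
    change (if m t univ ≤ 1 then m t else 0) _ = 0
    split_ifs with h
    · exact hm.2.1 t
    · simp
  · filter_upwards [hle] with t ht
    change _ = if m t univ ≤ 1 then m t else 0
    rw [if_pos]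
    have := hm.1 t
    rw [← ENNReal.ofReal_toReal this.ne]
    exact ENNReal.ofReal_le_one.2 ht

lemma poly_approx (H : ℝ × ℝ → ℝ) (hH : Continuous H) (K : Set (ℝ × ℝ)) (hK : IsCompact K)
    (ε : ℝ) (hε : 0 < ε) :
    ∃ p : MvPolynomial (Fin 2) ℝ, ∀ z ∈ K, |MvPolynomial.eval ![z.1, z.2] p - H z| < ε := by
  let f : Fin 2 → C(ℝ × ℝ, ℝ) := ![⟨Prod.fst, continuous_fst⟩, ⟨Prod.snd, continuous_snd⟩]
  have hsep : (Algebra.adjoin ℝ (Set.range f)).SeparatesPoints := by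
    intro x y hxy
    by_cases h1 : x.1 = y.1
    · have h2 : x.2 ≠ y.2 := fun h2 => hxy (Prod.ext h1 h2)
      exact ⟨_, ⟨f 1, Algebra.subset_adjoin ⟨1, rfl⟩, rfl⟩, h2⟩
    · exact ⟨_, ⟨f 0, Algebra.subset_adjoin ⟨0, rfl⟩, rfl⟩, h1⟩
  obtain ⟨g, hg, hgK⟩ :=
    ContinuousMap.exists_mem_subalgebra_near_continuous_of_isCompact_of_separatesPoints hsep
      ⟨H, hH⟩ hK hε
  rw [Algebra.adjoin_range_eq_range_aeval] at hg
  obtain ⟨p, rfl⟩ := hg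
  refine ⟨p, fun z hz => ?_⟩
  have h := hgK z hz
  have e : ∀ q : MvPolynomial (Fin 2) ℝ, (MvPolynomial.aeval f q) z = MvPolynomial.eval ![z.1, z.2] q := by
    intro q
    induction q using MvPolynomial.induction_on with
    | C a => simp
    | add p q hp hq => simp [hp, hq]
    | mul_X p i hp =>
      simp only [map_mul, MvPolynomial.aeval_X, MvPolynomial.eval_X, ContinuousMap.mul_apply, hp]
      fin_cases i <;> rfl
  rw [← e p]
  exact h

section abstract_part

open ProbabilityTheory

lemma kint {κ : Kernel ℝ (ℝ × ℝ)} [IsFiniteKernel κ] {F : ℝ → ℝ → ℝ}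
    (hF : Continuous (Function.uncurry F)) {C t : ℝ} (hC : ∀ x, |F t x| ≤ C) :
    Integrable (fun p : ℝ × ℝ => F t p.1) (κ t) := by
  refine Integrable.of_bound (C := C) ?_ (ae_of_all _ fun p => hC _)
  have : Continuous (fun p : ℝ × ℝ => F t p.1) :=
    hF.comp (continuous_const.prodMk continuous_fst)
  exact this.measurable.aestronglyMeasurable

lemma kmeas (κ : Kernel ℝ (ℝ × ℝ)) [IsFiniteKernel κ] {F : ℝ → ℝ → ℝ}
    (hF : Continuous (Function.uncurry F)) :
    Measurable (fun t => ∫ p, F t p.1 ∂(κ t)) := by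
  have : Continuous (fun q : ℝ × (ℝ × ℝ) => F q.1 q.2.1) :=
    hF.comp (continuous_fst.prodMk (continuous_fst.comp continuous_snd))
  exact (StronglyMeasurable.integral_kernel_prod_right' (κ := κ) this.stronglyMeasurable).measurable

lemma kbound {κ : Kernel ℝ (ℝ × ℝ)} (h1 : ∀ t, κ t univ ≤ 1) {F : ℝ → ℝ → ℝ}
    {C t : ℝ} (hC : ∀ x, |F t x| ≤ C) : |∫ p, F t p.1 ∂(κ t)| ≤ C := by
  haveI : IsFiniteMeasure (κ t) := ⟨(h1 t).trans_lt ENNReal.one_lt_top⟩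
  have hC0 : 0 ≤ C := (abs_nonneg _).trans (hC 0)
  have h := norm_integral_le_of_norm_le_const (μ := κ t) (f := fun p : ℝ × ℝ => F t p.1)
    (C := C) (ae_of_all _ fun p => hC _)
  refine h.trans ?_
  have : (κ t).real univ ≤ 1 := by
    rw [Measure.real]; exact ENNReal.toReal_le_of_le_ofReal zero_le_one (by simpa using h1 t)
  exact mul_le_of_le_one_right hC0 this

lemma kintI (T : ℝ) {κ : Kernel ℝ (ℝ × ℝ)} [IsFiniteKernel κ] (h1 : ∀ t, κ t univ ≤ 1)
    {F : ℝ → ℝ → ℝ}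
    (hF : Continuous (Function.uncurry F)) {C : ℝ} (hC : ∀ t ∈ Icc 0 T, ∀ x, |F t x| ≤ C) :
    Integrable (fun t => ∫ p, F t p.1 ∂(κ t)) (volume.restrict (Icc 0 T)) := by
  refine Integrable.of_bound (C := C) (kmeas κ hF).aestronglyMeasurable ?_
  filter_upwards [ae_restrict_mem measurableSet_Icc] with t ht
  exact kbound h1 (hC t ht)

/-- good test functions -/
def GoodTest (T : ℝ) (κn : ℕ → Kernel ℝ (ℝ × ℝ)) (κ : Kernel ℝ (ℝ × ℝ)) (F : ℝ → ℝ → ℝ) : Prop :=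
  Continuous (Function.uncurry F) ∧ (∃ C, ∀ t ∈ Icc 0 T, ∀ x, |F t x| ≤ C) ∧
  Tendsto (fun n => ∫ t in Icc 0 T, |(∫ p, F t p.1 ∂(κn n t)) - ∫ p, F t p.1 ∂(κ t)|) atTop (𝓝 0)

lemma GoodTest.add {T : ℝ} {κn : ℕ → Kernel ℝ (ℝ × ℝ)} {κ : Kernel ℝ (ℝ × ℝ)}
    [∀ n, IsFiniteKernel (κn n)] [IsFiniteKernel κ]
    (h1n : ∀ n t, κn n t univ ≤ 1) (h1 : ∀ t, κ t univ ≤ 1)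
    {F G : ℝ → ℝ → ℝ} (hF : GoodTest T κn κ F) (hG : GoodTest T κn κ G) :
    GoodTest T κn κ (fun t x => F t x + G t x) := by
  obtain ⟨cF, ⟨CF, bF⟩, tF⟩ := hF
  obtain ⟨cG, ⟨CG, bG⟩, tG⟩ := hG
  have cFG : Continuous (Function.uncurry fun t x => F t x + G t x) := cF.add cG
  have bFG : ∀ t ∈ Icc 0 T, ∀ x, |F t x + G t x| ≤ CF + CG := fun t ht x =>
    (abs_add_le _ _).trans (add_le_add (bF t ht x) (bG t ht x))
  refine ⟨cFG, ⟨CF + CG, bFG⟩, ?_⟩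
  have hs := tF.add tG
  rw [add_zero] at hs
  refine squeeze_zero (fun n => integral_nonneg fun t => abs_nonneg _) (fun n => ?_) hs
  have iF := ((kintI T (h1n n) cF bF).sub (kintI T h1 cF bF)).abs
  have iG := ((kintI T (h1n n) cG bG).sub (kintI T h1 cG bG)).abs
  have iFG := ((kintI T (h1n n) cFG bFG).sub (kintI T h1 cFG bFG)).abs
  have e := integral_add iF iG
  try simp only [Pi.sub_apply] at e
  rw [← e]
  refine integral_mono_ae iFG (iF.add iG) ?_
  filter_upwards [ae_restrict_mem measurableSet_Icc] with t ht
  try simp only [Pi.sub_apply, Pi.add_apply]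
  rw [integral_add (kint cF (bF t ht)) (kint cG (bG t ht)),
    integral_add (kint cF (bF t ht)) (kint cG (bG t ht))]
  rw [add_sub_add_comm]
  exact abs_add_le _ _

lemma GoodTest.mul_time {T : ℝ} {κn : ℕ → Kernel ℝ (ℝ × ℝ)} {κ : Kernel ℝ (ℝ × ℝ)}
    [∀ n, IsFiniteKernel (κn n)] [IsFiniteKernel κ]
    (h1n : ∀ n t, κn n t univ ≤ 1) (h1 : ∀ t, κ t univ ≤ 1)
    {F : ℝ → ℝ → ℝ} (hF : GoodTest T κn κ F) (θ : ℝ → ℝ) (hθ : Continuous θ) :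
    GoodTest T κn κ (fun t x => θ t * F t x) := by
  obtain ⟨cF, ⟨CF, bF⟩, tF⟩ := hF
  obtain ⟨B, hB⟩ := (isCompact_Icc (a := (0:ℝ)) (b := T)).exists_bound_of_continuousOn hθ.continuousOn
  have cG : Continuous (Function.uncurry fun t x => θ t * F t x) := (hθ.comp continuous_fst).mul cF
  have bG : ∀ t ∈ Icc 0 T, ∀ x, |θ t * F t x| ≤ B * CF := fun t ht x => by
    rw [abs_mul]
    exact mul_le_mul (hB t ht) (bF t ht x) (abs_nonneg _) ((norm_nonneg _).trans (hB t ht))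
  refine ⟨cG, ⟨_, bG⟩, ?_⟩
  have hs := tF.const_mul B
  rw [mul_zero] at hs
  refine squeeze_zero (fun n => integral_nonneg fun t => abs_nonneg _) (fun n => ?_) hs
  have iF := ((kintI T (h1n n) cF bF).sub (kintI T h1 cF bF)).abs
  have iG := ((kintI T (h1n n) cG bG).sub (kintI T h1 cG bG)).abs
  rw [← integral_const_mul]
  refine integral_mono_ae iG (iF.const_mul B) ?_
  filter_upwards [ae_restrict_mem measurableSet_Icc] with t ht
  try simp only [Pi.sub_apply]
  rw [integral_const_mul, integral_const_mul, ← mul_sub, abs_mul]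
  exact mul_le_mul_of_nonneg_right (hB t ht) (abs_nonneg _)

lemma good_smooth {T : ℝ} (hT : 0 < T) {κn : ℕ → Kernel ℝ (ℝ × ℝ)} {κ : Kernel ℝ (ℝ × ℝ)}
    [∀ n, IsFiniteKernel (κn n)] [IsFiniteKernel κ]
    (h1n : ∀ n t, κn n t univ ≤ 1) (h1 : ∀ t, κ t univ ≤ 1)
    (hconv : ∀ h : ℝ → ℝ × ℝ → ℝ, Continuous (fun q : ℝ × ℝ × ℝ => h q.1 q.2) →
      (∃ C : ℝ, ∀ t p, |h t p| ≤ C) →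
      Tendsto (fun n => ∫ t in Icc 0 T, (∫ p, h t p ∂(κn n t))) atTop
        (𝓝 (∫ t in Icc 0 T, (∫ p, h t p ∂(κ t)))))
    (hBV : ∀ (ψ ψ1 ψ2 : ℝ → ℝ) (D : ℝ), Continuous ψ → Continuous ψ1 → Continuous ψ2 →
      (∀ x, HasDerivAt ψ (ψ1 x) x) → (∀ x, HasDerivAt ψ1 (ψ2 x) x) →
      (∀ x, |ψ x| ≤ D ∧ |ψ1 x| ≤ D ∧ |ψ2 x| ≤ D) → ∃ K : ℝ,
      ∀ n (ρ : ℝ → ℝ) (B : ℝ), Continuous ρ → (∀ t ∈ Icc 0 T, |∫ s in (0:ℝ)..t, ρ s| ≤ B) →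
      |∫ t in Icc 0 T, ρ t * ∫ p, ψ p.1 ∂(κn n t)| ≤ K * B)
    (ψ : ℝ → ℝ) (hψ : ContDiff ℝ 2 ψ) (hψs : HasCompactSupport ψ) :
    GoodTest T κn κ (fun _ x => ψ x) := by
  have c1 : ContDiff ℝ 1 (deriv ψ) := by
    have : ContDiff ℝ (1 + 1) ψ := by simpa [one_add_one_eq_two] using hψ
    exact (contDiff_succ_iff_deriv.1 this).2.2
  have c2 : Continuous (deriv (deriv ψ)) := c1.continuous_deriv le_rfl
  obtain ⟨D0, hD0⟩ := hψs.exists_bound_of_continuous hψ.continuous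
  obtain ⟨D1, hD1⟩ := hψs.deriv.exists_bound_of_continuous c1.continuous
  obtain ⟨D2, hD2⟩ := hψs.deriv.deriv.exists_bound_of_continuous c2
  obtain ⟨K, hK⟩ := hBV ψ (deriv ψ) (deriv (deriv ψ)) (max D0 (max D1 D2)) hψ.continuous c1.continuous c2
    (fun x => ((hψ.differentiable (by norm_num)) x).hasDerivAt)
    (fun x => ((c1.differentiable (by norm_num)) x).hasDerivAt)
    (fun x => ⟨(hD0 x).trans (le_max_left _ _),
      (hD1 x).trans ((le_max_left _ _).trans (le_max_right _ _)),
      (hD2 x).trans ((le_max_right _ _).trans (le_max_right _ _))⟩)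
  have cF : Continuous (Function.uncurry fun (_ : ℝ) x => ψ x) := hψ.continuous.comp continuous_snd
  refine ⟨cF, ⟨D0, fun t _ x => hD0 x⟩, ?_⟩
  refine L1_conv_of_BV T hT (fun n t => ∫ p, ψ p.1 ∂(κn n t)) (fun t => ∫ p, ψ p.1 ∂(κ t)) D0 K
    (fun n => kmeas (κn n) cF) (kmeas κ cF)
    (fun n t => kbound (F := fun _ x => ψ x) (h1n n) hD0)
    (fun t => kbound (F := fun _ x => ψ x) h1 hD0) ?_ hK
  intro η hη ⟨C, hC⟩
  have := hconv (fun t p => η t * ψ p.1)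
    ((hη.comp continuous_fst).mul (hψ.continuous.comp (continuous_fst.comp continuous_snd)))
    ⟨C * D0, fun t p => by
      rw [abs_mul]
      exact mul_le_mul (hC t) (hD0 _) (abs_nonneg _) ((abs_nonneg _).trans (hC t))⟩
  simpa [integral_const_mul] using this

lemma good_all {T : ℝ} (hT : 0 < T) {κn : ℕ → Kernel ℝ (ℝ × ℝ)} {κ : Kernel ℝ (ℝ × ℝ)}
    [∀ n, IsFiniteKernel (κn n)] [IsFiniteKernel κ]
    (h1n : ∀ n t, κn n t univ ≤ 1) (h1 : ∀ t, κ t univ ≤ 1)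
    (hconv : ∀ h : ℝ → ℝ × ℝ → ℝ, Continuous (fun q : ℝ × ℝ × ℝ => h q.1 q.2) →
      (∃ C : ℝ, ∀ t p, |h t p| ≤ C) →
      Tendsto (fun n => ∫ t in Icc 0 T, (∫ p, h t p ∂(κn n t))) atTop
        (𝓝 (∫ t in Icc 0 T, (∫ p, h t p ∂(κ t)))))
    (hBV : ∀ (ψ ψ1 ψ2 : ℝ → ℝ) (D : ℝ), Continuous ψ → Continuous ψ1 → Continuous ψ2 →
      (∀ x, HasDerivAt ψ (ψ1 x) x) → (∀ x, HasDerivAt ψ1 (ψ2 x) x) →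
      (∀ x, |ψ x| ≤ D ∧ |ψ1 x| ≤ D ∧ |ψ2 x| ≤ D) → ∃ K : ℝ,
      ∀ n (ρ : ℝ → ℝ) (B : ℝ), Continuous ρ → (∀ t ∈ Icc 0 T, |∫ s in (0:ℝ)..t, ρ s| ≤ B) →
      |∫ t in Icc 0 T, ρ t * ∫ p, ψ p.1 ∂(κn n t)| ≤ K * B)
    (H : ℝ → ℝ → ℝ) (hH : Continuous (Function.uncurry H)) (C : ℝ) (hC : ∀ t x, |H t x| ≤ C) :
    Tendsto (fun n => ∫ t in Icc 0 T, |(∫ p, H t p.1 ∂(κn n t)) - ∫ p, H t p.1 ∂(κ t)|)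
      atTop (𝓝 0) := by
  have hC0 : 0 ≤ C := (abs_nonneg _).trans (hC 0 0)
  -- cutoffs
  let χ : ℕ → ContDiffBump (0:ℝ) := fun k => ⟨(k:ℝ) + 1, (k:ℝ) + 2, by positivity, by linarith⟩
  have hχc : ∀ k, Continuous (χ k) := fun k => (χ k).continuous
  have c1χ : ∀ k, Continuous (Function.uncurry fun (_:ℝ) x => 1 - χ k x) := fun k =>
    continuous_const.sub ((hχc k).comp continuous_snd)
  have b1χ : ∀ k x, |1 - χ k x| ≤ 1 := fun k x => by
    rw [abs_of_nonneg (by linarith [(χ k).le_one (x := x)])]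
    linarith [(χ k).nonneg' x]
  -- tightness
  have htight : Tendsto (fun k => ∫ t in Icc 0 T, ∫ p, (1 - χ k p.1) ∂(κ t)) atTop (𝓝 0) := by
    have z : ∫ t in Icc 0 T, (∫ p : ℝ × ℝ, (0:ℝ) ∂(κ t)) = 0 := by simp
    suffices hlim : Tendsto (fun k => ∫ t in Icc 0 T, ∫ p, (1 - χ k p.1) ∂(κ t)) atTop
        (𝓝 (∫ t in Icc 0 T, (∫ p : ℝ × ℝ, (0:ℝ) ∂(κ t)))) by
      rw [z] at hlim
      exact hlim
    refine tendsto_integral_of_dominated_convergence (fun _ => 1) ?_ (integrable_const _) ?_ ?_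
    · intro k
      exact (kmeas κ (c1χ k)).aestronglyMeasurable
    · intro k
      exact ae_of_all _ fun t => kbound (F := fun _ x => 1 - χ k x) h1 (b1χ k)
    · refine ae_of_all _ fun t => ?_
      refine tendsto_integral_of_dominated_convergence (fun _ => 1) ?_ (integrable_const _) ?_ ?_
      · intro k
        exact (continuous_const.sub ((hχc k).comp continuous_fst)).aestronglyMeasurable
      · intro k
        exact ae_of_all _ fun p => b1χ k p.1
      · refine ae_of_all _ fun p => ?_
        refine tendsto_const_nhds.congr' ?_
        obtain ⟨N, hN⟩ := exists_nat_gt |p.1|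
        filter_upwards [eventually_ge_atTop N] with k hk
        have : (χ k) p.1 = 1 := by
          apply (χ k).one_of_mem_closedBall
          rw [mem_closedBall_zero_iff, Real.norm_eq_abs]
          have hk' : (N:ℝ) ≤ k := by exact_mod_cast hk
          change _ ≤ (k:ℝ) + 1
          linarith
        rw [this, sub_self]
  rw [Metric.tendsto_nhds]
  intro ε hε
  obtain ⟨δ, hδ⟩ : ∃ δ, δ = ε / (2 * C + 2 * T + 3) := ⟨_, rfl⟩
  have hδ0 : 0 < δ := by rw [hδ]; positivity
  obtain ⟨k, hk⟩ := (htight.eventually_lt_const hδ0).exists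
  have hcn := hconv (fun _ p => 1 - χ k p.1)
    (continuous_const.sub ((hχc k).comp (continuous_fst.comp continuous_snd)))
    ⟨1, fun t p => b1χ k p.1⟩
  obtain ⟨P, hP⟩ := poly_approx (fun z => H z.1 z.2) hH
    (Icc 0 T ×ˢ Metric.closedBall 0 ((k:ℝ) + 2)) (isCompact_Icc.prod (isCompact_closedBall _ _)) δ hδ0
  have hgood : ∀ Q : MvPolynomial (Fin 2) ℝ,
      GoodTest T κn κ (fun t x => χ k x * MvPolynomial.eval ![t, x] Q) := by
    intro Q
    induction Q using MvPolynomial.induction_on' with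
    | monomial u a =>
      have hs : GoodTest T κn κ (fun _ x => χ k x * x ^ (u 1)) := by
        apply good_smooth hT h1n h1 hconv hBV
        · exact (χ k).contDiff.mul (contDiff_id.pow _)
        · exact (χ k).hasCompactSupport.mul_right
      have h2 := hs.mul_time h1n h1 (fun t => a * t ^ (u 0)) (by fun_prop)
      convert h2 using 3 with t x
      simp [MvPolynomial.eval_monomial, Finsupp.prod_fintype, Fin.prod_univ_two]
      ring
    | add p q hp hq =>
      have h2 := hp.add h1n h1 hq
      convert h2 using 3 with t x
      rw [map_add, mul_add]
  obtain ⟨cG, ⟨CG, bG⟩, tG⟩ := hgood P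
  have bH : ∀ t ∈ Icc 0 T, ∀ x, |H t x| ≤ C := fun t _ x => hC t x
  set G : ℝ → ℝ → ℝ := fun t x => χ k x * MvPolynomial.eval ![t, x] P with hG
  -- pointwise bound
  have hpt : ∀ t ∈ Icc 0 T, ∀ x, |H t x - G t x| ≤ C * (1 - χ k x) + δ := by
    intro t ht x
    have x0 := (χ k).nonneg' x
    have x1 := (χ k).le_one (x := x)
    have e : H t x - G t x = H t x * (1 - χ k x)
        - χ k x * (MvPolynomial.eval ![t, x] P - H t x) := by simp only [hG]; ring
    have e1 : |H t x * (1 - χ k x)| ≤ C * (1 - χ k x) := by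
      rw [abs_mul, abs_of_nonneg (a := 1 - χ k x) (by linarith)]
      exact mul_le_mul_of_nonneg_right (hC t x) (by linarith)
    have e2 : |χ k x * (MvPolynomial.eval ![t, x] P - H t x)| ≤ δ := by
      by_cases hx : x ∈ Metric.closedBall (0:ℝ) ((k:ℝ) + 2)
      · have := hP (t, x) ⟨ht, hx⟩
        rw [abs_mul, abs_of_nonneg x0]
        calc _ ≤ 1 * δ := mul_le_mul x1 this.le (abs_nonneg _) zero_le_one
          _ = δ := one_mul _
      · have : χ k x = 0 := by
          apply (χ k).zero_of_le_dist
          rw [Metric.mem_closedBall, not_le] at hx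
          exact hx.le
        rw [this, zero_mul, abs_zero]; exact hδ0.le
    rw [e]
    exact (abs_sub _ _).trans (add_le_add e1 e2)
  have hI : ∀ (τ : Kernel ℝ (ℝ × ℝ)) [IsFiniteKernel τ], (∀ t, τ t univ ≤ 1) → ∀ t ∈ Icc 0 T,
      |(∫ p, H t p.1 ∂(τ t)) - ∫ p, G t p.1 ∂(τ t)| ≤ C * (∫ p, (1 - χ k p.1) ∂(τ t)) + δ := by
    intro τ _ hτ t ht
    rw [← integral_sub (kint hH (hC t)) (kint cG (bG t ht))]
    have i1 : Integrable (fun p : ℝ × ℝ => 1 - χ k p.1) (τ t) :=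
      kint (F := fun _ x => 1 - χ k x) (t := t) (c1χ k) (b1χ k)
    calc _ ≤ ∫ p, |H t p.1 - G t p.1| ∂(τ t) := abs_integral_le_integral_abs
      _ ≤ ∫ p, (C * (1 - χ k p.1) + δ) ∂(τ t) := by
          refine integral_mono ((kint hH (hC t)).sub (kint cG (bG t ht))).abs
            ((i1.const_mul C).add (integrable_const _)) ?_
          intro p
          exact hpt t ht p.1
      _ = C * (∫ p, (1 - χ k p.1) ∂(τ t)) + (τ t).real univ * δ := by
          rw [integral_add (i1.const_mul C) (integrable_const _), integral_const_mul]
          simp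
      _ ≤ _ := by
          have : (τ t).real univ ≤ 1 := by
            rw [Measure.real]
            exact ENNReal.toReal_le_of_le_ofReal zero_le_one (by simpa using hτ t)
          have := mul_le_of_le_one_left hδ0.le this
          linarith
  filter_upwards [tG.eventually_lt_const hδ0, hcn.eventually_lt_const hk] with n hn1 hn2
  have h0 : 0 ≤ ∫ t in Icc 0 T, |(∫ p, H t p.1 ∂(κn n t)) - ∫ p, H t p.1 ∂(κ t)| :=
    integral_nonneg fun t => abs_nonneg _
  rw [Real.dist_eq, sub_zero, abs_of_nonneg h0]
  have iH := ((kintI T (h1n n) hH bH).sub (kintI T h1 hH bH)).abs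
  have iG := ((kintI T (h1n n) cG bG).sub (kintI T h1 cG bG)).abs
  have i1 : Integrable (fun t => ∫ p, (1 - χ k p.1) ∂(κn n t)) (volume.restrict (Icc 0 T)) :=
    kintI T (F := fun _ x => 1 - χ k x) (h1n n) (c1χ k) (fun _ _ => b1χ k)
  have i2 : Integrable (fun t => ∫ p, (1 - χ k p.1) ∂(κ t)) (volume.restrict (Icc 0 T)) :=
    kintI T (F := fun _ x => 1 - χ k x) h1 (c1χ k) (fun _ _ => b1χ k)
  have j1 := (i1.const_mul C).add (integrable_const (μ := volume.restrict (Icc 0 T)) δ)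
  have j2 := (i2.const_mul C).add (integrable_const (μ := volume.restrict (Icc 0 T)) δ)
  have hle := integral_mono_ae iH ((iG.add j1).add j2) (by
    filter_upwards [ae_restrict_mem measurableSet_Icc] with t ht
    have a1 := hI (κn n) (h1n n) t ht
    have a2 := hI κ h1 t ht
    simp only [Pi.add_apply, Pi.sub_apply]
    have e : (∫ p, H t p.1 ∂(κn n t)) - ∫ p, H t p.1 ∂(κ t)
      = ((∫ p, G t p.1 ∂(κn n t)) - ∫ p, G t p.1 ∂(κ t))
        + ((∫ p, H t p.1 ∂(κn n t)) - ∫ p, G t p.1 ∂(κn n t))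
        - ((∫ p, H t p.1 ∂(κ t)) - ∫ p, G t p.1 ∂(κ t)) := by ring
    rw [e]
    exact (abs_sub _ _).trans (add_le_add ((abs_add_le _ _).trans (add_le_add le_rfl a1)) a2))
  rw [integral_add' (iG.add j1) j2, integral_add' iG j1,
    integral_add' (i1.const_mul C) (integrable_const _),
    integral_add' (i2.const_mul C) (integrable_const _), integral_const_mul, integral_const_mul] at hle
  have hδT : ∫ t in Icc 0 T, δ = T * δ := by simp [hT.le]
  rw [hδT] at hle
  try simp only [Pi.sub_apply] at hle
  have f1 := mul_le_mul_of_nonneg_left hn2.le hC0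
  have f2 := mul_le_mul_of_nonneg_left hk.le hC0
  have f3 : (2 * C + 2 * T + 3) * δ = ε := by rw [hδ]; field_simp
  nlinarith

end abstract_part

lemma tietze_bdd (s : Set (ℝ × ℝ)) (hs : IsClosed s) (h : ℝ × ℝ → ℝ) (hh : ContinuousOn h s)
    (C : ℝ) (hC : ∀ z ∈ s, |h z| ≤ C) :
    ∃ H : ℝ × ℝ → ℝ, Continuous H ∧ (∀ z, |H z| ≤ |C|) ∧ ∀ z ∈ s, H z = h z := by
  let f : C(s, ℝ) := ⟨s.restrict h, hh.restrict⟩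
  obtain ⟨g, hg, hgf⟩ := ContinuousMap.exists_restrict_eq_forall_mem_of_closed f
    (t := Icc (-|C|) |C|) (fun z => abs_le.1 ((hC z.1 z.2).trans (le_abs_self C)))
    ⟨0, by simp⟩ hs
  refine ⟨g, g.continuous, fun z => abs_le.2 (hg z), fun z hz => ?_⟩
  have := congrArg (fun q : C(s, ℝ) => q ⟨z, hz⟩) hgf
  exact this

/-- Admissibility limit within `R₀`: if `(μⁿ, mⁿ) ⊆ R₀` and
`mⁿ → m` in `V` for some `m ∈ V`, then `m_t(Ō×A) ≤ 1` for Lebesgue-a.e. `t ∈ [0,T]`,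
and for every bounded continuous `h : [0,T]×Ō → ℝ` the functions
`t ↦ ∫ h(t,x) m_tⁿ(dx,da)` converge, up to extraction of a subsequence, to
`t ↦ ∫ h(t,x) m_t(dx,da)` in `L¹([0,T])`. -/
theorem memR0_limit_admissibility
    (T : ℝ) (hT : 0 < T) (O A : Set ℝ) (hO : IsOpen O) (hA : IsCompact A)
    (d : ℕ) (hd : 0 < d)
    (b σ : ℝ → ℝ → Measure (ℝ × ℝ) → ℝ → ℝ)
    (bbar σbar : ℝ → ℝ → (Fin d → ℝ) → ℝ → ℝ) (bhat σhat : ℝ → ℝ → Fin d → ℝ)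
    (hb : MFCoeff T O A d b bbar bhat) (hσ : MFCoeff T O A d σ σbar σhat)
    (hσpos : ∀ t x ν a, 0 ≤ σ t x ν a)
    (m0 : Measure ℝ) (hm0 : InitAssumption2 O m0)
    (μn : ℕ → Measure (ℝ × ℝ)) (mn : ℕ → ℝ → Measure (ℝ × ℝ))
    (hR0 : ∀ n, MemR0 T O A b σ m0 (μn n) (mn n))
    (m : ℝ → Measure (ℝ × ℝ)) (hm : MemV T O A m) (hconv : ConvV T mn m) :
    (∀ᵐ t ∂(volume.restrict (Set.Icc 0 T)), m t (closure O ×ˢ A) ≤ 1) ∧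
    (∀ h : ℝ → ℝ → ℝ,
      ContinuousOn (fun p : ℝ × ℝ => h p.1 p.2) (Set.Icc 0 T ×ˢ closure O) →
      (∃ C : ℝ, ∀ t ∈ Set.Icc (0:ℝ) T, ∀ x ∈ closure O, |h t x| ≤ C) →
      ∃ φ : ℕ → ℕ, StrictMono φ ∧
        Tendsto
          (fun k => ∫ t in Set.Icc 0 T,
            |(∫ p, h t p.1 ∂(mn (φ k) t)) - (∫ p, h t p.1 ∂(m t))|)
          atTop (nhds 0)) := by
  -- masses are at most one along the sequence
  have hn1 : ∀ n, ∀ᵐ t ∂(volume.restrict (Icc 0 T)), ((mn n t) univ).toReal ≤ 1 := fun n =>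
    ae_le_one_of_test T _ (hR0 n).2.2.1.2.2.2 ((hR0 n).2.2.1.2.2.1 univ .univ).ennreal_toReal
      (fun η hη hη0 _ => R0_mass_le_one (hR0 n) η hη hη0)
  have hm1 : ∀ᵐ t ∂(volume.restrict (Icc 0 T)), ((m t) univ).toReal ≤ 1 := by
    refine ae_le_one_of_test T _ hm.2.2.2 (hm.2.2.1 univ .univ).ennreal_toReal ?_
    intro η hη hη0 hη1
    have hl := hconv (fun t _ => η t) (hη.comp continuous_fst)
      ⟨1, fun t _ => abs_le.2 ⟨by linarith [hη0 t], hη1 t⟩⟩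
    simp only [integral_const, smul_eq_mul, Measure.real] at hl
    have e : ∫ t in Icc 0 T, η t * ((m t) univ).toReal
        = ∫ t in Icc 0 T, ((m t) univ).toReal * η t := by
      simp only [mul_comm]
    rw [e]
    refine le_of_tendsto' hl fun n => ?_
    have := R0_mass_le_one (hR0 n) η hη hη0
    simpa only [mul_comm] using this
  refine ⟨?_, ?_⟩
  · filter_upwards [hm1] with t ht
    refine (measure_mono (subset_univ _)).trans ?_
    rw [← ENNReal.ofReal_toReal (hm.1 t).ne]
    exact ENNReal.ofReal_le_one.2 ht
  intro h hh hhC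
  obtain ⟨C, hC⟩ := hhC
  choose κn hκn1 hκn0 hκne using fun n => exists_kernel (hR0 n).2.2.1 (hn1 n)
  obtain ⟨κ, hκ1, hκ0, hκe⟩ := exists_kernel hm hm1
  haveI : ∀ n, ProbabilityTheory.IsFiniteKernel (κn n) := fun n =>
    ⟨⟨1, ENNReal.one_lt_top, hκn1 n⟩⟩
  haveI : ProbabilityTheory.IsFiniteKernel κ := ⟨⟨1, ENNReal.one_lt_top, hκ1⟩⟩
  obtain ⟨Cb, hCb⟩ := hb.2.2.1
  obtain ⟨Cs, hCs⟩ := hσ.2.2.1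
  have hb' : ∀ t x ν a, |b t x ν a| ≤ Cb := fun t x ν a => by rw [hb.2.1]; exact hCb _ _ _ _
  have hs' : ∀ t x ν a, |σ t x ν a| ≤ Cs := fun t x ν a => by rw [hσ.2.1]; exact hCs _ _ _ _
  obtain ⟨H, cH, bH, eH⟩ := tietze_bdd (Icc 0 T ×ˢ closure O) (isClosed_Icc.prod isClosed_closure)
    (fun p => h p.1 p.2) hh C (fun z hz => hC z.1 hz.1 z.2 hz.2)
  have key := good_all (κn := κn) (κ := κ) hT hκn1 hκ1
    (by
      intro g hg hgC
      have hl := hconv g hg hgC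
      have e : ∫ t in Icc 0 T, (∫ p, g t p ∂(m t)) = ∫ t in Icc 0 T, (∫ p, g t p ∂(κ t)) := by
        refine integral_congr_ae ?_
        filter_upwards [hκe] with t ht
        rw [ht]
      rw [e] at hl
      refine hl.congr fun n => integral_congr_ae ?_
      filter_upwards [hκne n] with t ht
      rw [ht])
    (by
      intro ψ ψ1 ψ2 D c0 c1 c2 d1 d2 hD
      refine ⟨D + (Cb * D + Cs ^ 2 / 2 * D) * T, fun n ρ B hρ hB => ?_⟩
      have hl := R0_BV hT Cb Cs hb' hs' ψ ψ1 ψ2 D c0 c1 c2 d1 d2 hD (hR0 n) ρ B hρ hB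
      have e : ∫ t in Icc 0 T, ρ t * (∫ p, ψ p.1 ∂(mn n t))
          = ∫ t in Icc 0 T, ρ t * (∫ p, ψ p.1 ∂(κn n t)) := by
        refine integral_congr_ae ?_
        filter_upwards [hκne n] with t ht
        rw [ht]
      rwa [e] at hl)
    (fun t x => H (t, x)) cH |C| (fun t x => bH _)
  have hker : ∀ τ : ProbabilityTheory.Kernel ℝ (ℝ × ℝ), (∀ t, τ t ((closure O ×ˢ A)ᶜ) = 0) →
      ∀ t ∈ Icc 0 T, ∫ p, H (t, p.1) ∂(τ t) = ∫ p, h t p.1 ∂(τ t) := by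
    intro τ hτ t ht
    refine integral_congr_ae ?_
    have : ∀ᵐ p ∂(τ t), p ∈ closure O ×ˢ A := hτ t
    filter_upwards [this] with p hp
    exact eH (t, p.1) ⟨ht, hp.1⟩
  refine ⟨id, strictMono_id, key.congr fun n => integral_congr_ae ?_⟩
  filter_upwards [hκe, hκne n, ae_restrict_mem measurableSet_Icc] with t h1 h2 ht
  rw [hker _ (hκn0 n) t ht, hker _ hκ0 t ht, id, h1, h2]
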